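/- arXiv:1108.1245 — 8 statements merged into one kernel-verified Lean document; each statement's English description precedes it below -/
import Mathlib

section
/- Let D be a division ring, φ a ring automorphism of D, x ∈ D with x ≠ 0, and ξ ∈ D with ξ ≠ 0 such that φ(ξ) = ξ and ξ * x = φ^[a](x) * ξ for a natural number a. If φ^[r] = id_D for some integer r ≥ 1, then applying the right mutation w ↦ ξ * w⁻¹ exactly 2r times to x returns x, and applying the left mutation w ↦ w⁻¹ * ξ exactly 2r times to x also returns x. Equivalently, if z : ℤ → D is the mutation sequence for (x, ξ), then z (2r) = x and z (−2r) = x. -/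
/-- Corollary 3.13: for a balanced φ-commutative rank-one preseed (frozen component `a`,
exchange element `ξ`), if `φ^[r] = id` then applying the right mutation `2r` times to `x`
returns `x`, and likewise for the left mutation; in terms of the mutation sequence
`z : ℤ → D` for `(x, ξ)`, one has `z (2r) = x` and `z (-(2r)) = x`. -/
theorem statement3 {D : Type*} [DivisionRing D] (φ : D ≃+* D) (x ξ : D)
    (hx : x ≠ 0) (hξ : ξ ≠ 0) (a : ℕ)
    (hfix : φ ξ = ξ) (hcomm : ξ * x = (⇑φ)^[a] x * ξ)
    (r : ℕ) (hr : 1 ≤ r) (hord : (⇑φ)^[r] = id)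
    (z : ℤ → D) (hz0 : z 0 = x) (hz : ∀ k : ℤ, z (k + 1) = ξ * (z k)⁻¹) :
    z (2 * r) = x ∧ z (-(2 * r)) = x := by
  have step : ∀ k : ℤ, ξ * z k = z (k + 2) * ξ := by
    intro k
    have h : z (k + 2) = ξ * (ξ * (z k)⁻¹)⁻¹ := by
      rw [← hz k, ← hz (k + 1)]
      congr 1
      ring
    rw [h, mul_inv_rev, inv_inv, mul_assoc, mul_assoc, inv_mul_cancel₀ hξ, mul_one]
  have steps : ∀ (n : ℕ) (k : ℤ), ξ ^ n * z k = z (k + 2 * n) * ξ ^ n := by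
    intro n
    induction n with
    | zero => intro k; simp
    | succ n ih =>
      intro k
      rw [pow_succ, mul_assoc, step, ← mul_assoc, ih, mul_assoc]
      congr 2
      push_cast
      ring
  have hfixn : ∀ m : ℕ, (⇑φ)^[m] ξ = ξ := fun m => Function.iterate_fixed hfix m
  have hmul : ∀ (m : ℕ) (u v : D), (⇑φ)^[m] (u * v) = (⇑φ)^[m] u * (⇑φ)^[m] v :=
    fun m u v => iterate_map_mul φ m u v
  have hpow : ∀ n : ℕ, ξ ^ n * x = (⇑φ)^[a * n] x * ξ ^ n := by
    intro n
    induction n with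
    | zero => simp
    | succ n ih =>
      have h := congrArg (⇑φ)^[a * n] hcomm
      rw [hmul, hmul, hfixn, ← Function.iterate_add_apply] at h
      rw [pow_succ', mul_assoc, ih, ← mul_assoc, h, mul_assoc]
      rfl
  have hc : ξ ^ r * x = x * ξ ^ r := by
    have h := hpow r
    rwa [mul_comm a r, Function.iterate_mul, hord, Function.iterate_id, id] at h
  have hp : ξ ^ r ≠ 0 := pow_ne_zero r hξ
  constructor
  · have h := steps r 0
    rw [hz0, hc, zero_add] at h
    exact (mul_right_cancel₀ hp h).symm
  · have h := steps r (-(2 * r))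
    rw [neg_add_cancel, hz0, ← hc] at h
    exact mul_left_cancel₀ hp h
end

section
/- Let D be a division ring and x, ξ ∈ D with x ≠ 0 and ξ ≠ 0, and let z : ℤ → D be the mutation sequence for (x, ξ). Then for every l ∈ ℤ: z (2l) = ξ^l * x * ξ^(−l) and z (2l+1) = ξ^(l+1) * x⁻¹ * ξ^(−l), where ξ^m denotes the m-th integer power of the nonzero element ξ. In particular z k ≠ 0 for every k ∈ ℤ. -/
/-- The closed form (4.14) for the rank-one mutation sequence: `z (2l) = ξ^l * x * ξ^(-l)`
and `z (2l+1) = ξ^(l+1) * x⁻¹ * ξ^(-l)`; in particular every cluster variable is nonzero. -/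
theorem statement4 {D : Type*} [DivisionRing D] (x ξ : D) (hx : x ≠ 0) (hξ : ξ ≠ 0)
    (z : ℤ → D) (hz0 : z 0 = x) (hz : ∀ k : ℤ, z (k + 1) = ξ * (z k)⁻¹) :
    (∀ l : ℤ, z (2 * l) = ξ ^ l * x * ξ ^ (-l) ∧
      z (2 * l + 1) = ξ ^ (l + 1) * x⁻¹ * ξ ^ (-l)) ∧
    ∀ k : ℤ, z k ≠ 0 := by
  have h2 : ∀ k : ℤ, z (k + 2) = ξ * z k * ξ⁻¹ := by
    intro k
    have h : k + 2 = (k + 1) + 1 := by ring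
    rw [h, hz, hz, mul_inv_rev, inv_inv, mul_assoc]
  have he : ∀ l : ℤ, z (2 * l) = ξ ^ l * x * ξ ^ (-l) := by
    intro l
    induction l using Int.induction_on with
    | zero => simp [hz0]
    | succ n ih =>
      have h : 2 * ((n : ℤ) + 1) = 2 * n + 2 := by ring
      have h' : -((n : ℤ) + 1) = -n + -1 := by ring
      rw [h, h2, ih, h', zpow_add₀ hξ (-(n : ℤ)), add_comm (n : ℤ) 1, zpow_add₀ hξ 1,
        zpow_one, zpow_neg_one]
      simp only [mul_assoc]
    | pred n ih =>
      have h := h2 (2 * (-(n : ℤ) - 1))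
      have e : 2 * (-(n : ℤ) - 1) + 2 = 2 * (-n) := by ring
      rw [e, ih] at h
      have h3 : z (2 * (-(n : ℤ) - 1)) = ξ⁻¹ * (ξ ^ (-(n : ℤ)) * x * ξ ^ (- -(n : ℤ))) * ξ := by
        rw [h]
        simp [mul_assoc, hξ]
      have e1 : -(n : ℤ) - 1 = -1 + -n := by ring
      have e2 : -(-(n : ℤ) - 1) = - -(n : ℤ) + 1 := by ring
      rw [h3, e2, e1, zpow_add₀ hξ (-1), zpow_add₀ hξ _ 1, zpow_one, zpow_neg_one]
      simp only [mul_assoc]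
  have ho : ∀ l : ℤ, z (2 * l + 1) = ξ ^ (l + 1) * x⁻¹ * ξ ^ (-l) := by
    intro l
    rw [hz, he, add_comm l 1, zpow_add₀ hξ 1, zpow_one, mul_inv_rev, mul_inv_rev, zpow_neg,
      inv_inv]
    simp only [mul_assoc]
  refine ⟨fun l => ⟨he l, ho l⟩, fun k => ?_⟩
  obtain ⟨l, rfl | rfl⟩ := Int.even_or_odd' k
  · rw [he]
    exact mul_ne_zero (mul_ne_zero (zpow_ne_zero _ hξ) hx) (zpow_ne_zero _ hξ)
  · rw [ho]
    exact mul_ne_zero (mul_ne_zero (zpow_ne_zero _ hξ) (inv_ne_zero hx)) (zpow_ne_zero _ hξ)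
end

section
/- Let D be a division ring and x, ξ ∈ D with x ≠ 0 and ξ ≠ 0, and let z : ℤ → D be the mutation sequence for (x, ξ). Then every cluster variable z k (k ∈ ℤ) belongs to the subring of D generated by the four elements x, x⁻¹, ξ, ξ⁻¹. -/
/-- The rank-one Laurent-type phenomenon (Theorem 4.12(2)): every cluster variable of the
mutation sequence for `(x, ξ)` lies in the subring of `D` generated by `x, x⁻¹, ξ, ξ⁻¹`. -/
theorem statement5 {D : Type*} [DivisionRing D] (x ξ : D) (hx : x ≠ 0) (hξ : ξ ≠ 0)
    (z : ℤ → D) (hz0 : z 0 = x) (hz : ∀ k : ℤ, z (k + 1) = ξ * (z k)⁻¹) :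
    ∀ k : ℤ, z k ∈ Subring.closure ({x, x⁻¹, ξ, ξ⁻¹} : Set D) := by
  have h1 : x ∈ Subring.closure ({x, x⁻¹, ξ, ξ⁻¹} : Set D) :=
    Subring.subset_closure (by simp)
  have h2 : x⁻¹ ∈ Subring.closure ({x, x⁻¹, ξ, ξ⁻¹} : Set D) :=
    Subring.subset_closure (by simp)
  have h3 : ξ ∈ Subring.closure ({x, x⁻¹, ξ, ξ⁻¹} : Set D) :=
    Subring.subset_closure (by simp)
  have h4 : ξ⁻¹ ∈ Subring.closure ({x, x⁻¹, ξ, ξ⁻¹} : Set D) :=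
    Subring.subset_closure (by simp)
  generalize Subring.closure ({x, x⁻¹, ξ, ξ⁻¹} : Set D) = S at *
  have key : ∀ k : ℤ, z k ∈ S ∧ (z k)⁻¹ ∈ S := by
    intro k
    induction k using Int.induction_on with
    | zero => rw [hz0]; exact ⟨h1, h2⟩
    | succ i ih =>
      rw [hz, mul_inv_rev, inv_inv]
      exact ⟨S.mul_mem h3 ih.2, S.mul_mem ih.1 h4⟩
    | pred i ih =>
      have e := hz (-(i : ℤ) - 1)
      rw [sub_add_cancel] at e
      have e' : z (-(i : ℤ) - 1) = (z (-(i : ℤ)))⁻¹ * ξ := by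
        rw [e, mul_inv_rev, inv_inv, mul_assoc, inv_mul_cancel₀ hξ, mul_one]
      rw [e', mul_inv_rev, inv_inv]
      exact ⟨S.mul_mem ih.2 h3, S.mul_mem h4 ih.1⟩
  exact fun k => (key k).1
end

section
/- Let D be a division ring, φ a ring automorphism of D, x, ξ ∈ D with x ≠ 0, ξ ≠ 0, φ(ξ) = ξ, and ξ * x = φ^[a](x) * ξ for a natural number a. Let z : ℤ → D be the mutation sequence for (x, ξ). Then for every l ∈ ℤ: z (2l) = φ^(l·a)(x) and z (2l+1) = φ^((l+1)·a)(x⁻¹) * ξ, where φ^m for m ∈ ℤ denotes the m-th power of φ in the group of ring automorphisms of D. Consequently the cluster set of (x, ξ) equals {φ^(l·a)(x) : l ∈ ℤ} ∪ {φ^(l·a)(x⁻¹) * ξ : l ∈ ℤ}. -/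
/-- Explicit description of the cluster set of a balanced φ-commutative rank-one preseed:
`z (2l) = φ^(l·a) x`, `z (2l+1) = φ^((l+1)·a) x⁻¹ * ξ`, and hence the cluster set is
`{φ^(l·a) x : l ∈ ℤ} ∪ {φ^(l·a) x⁻¹ * ξ : l ∈ ℤ}`. -/
theorem statement6 {D : Type*} [DivisionRing D] (φ : RingAut D) (x ξ : D)
    (hx : x ≠ 0) (hξ : ξ ≠ 0) (a : ℕ)
    (hfix : φ ξ = ξ) (hcomm : ξ * x = (⇑φ)^[a] x * ξ)
    (z : ℤ → D) (hz0 : z 0 = x) (hz : ∀ k : ℤ, z (k + 1) = ξ * (z k)⁻¹) :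
    (∀ l : ℤ, z (2 * l) = (φ ^ (l * (a : ℤ))) x ∧
      z (2 * l + 1) = (φ ^ ((l + 1) * (a : ℤ))) x⁻¹ * ξ) ∧
    Set.range z =
      {y : D | ∃ l : ℤ, y = (φ ^ (l * (a : ℤ))) x} ∪
      {y : D | ∃ l : ℤ, y = (φ ^ (l * (a : ℤ))) x⁻¹ * ξ} := by
  have hfixN : ∀ n : ℕ, (φ ^ n) ξ = ξ := by
    intro n
    induction n with
    | zero => simp
    | succ n ih => rw [pow_succ, RingAut.mul_apply, hfix, ih]
  have hfixZ : ∀ n : ℤ, (φ ^ n) ξ = ξ := by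
    intro n
    obtain ⟨m, rfl | rfl⟩ := n.eq_nat_or_neg
    · rw [zpow_natCast]; exact hfixN m
    · have h : (φ ^ (-(m : ℤ))) ((φ ^ m) ξ) = ξ := by
        rw [← RingAut.mul_apply, ← zpow_natCast, ← zpow_add]; simp
      rwa [hfixN] at h
  have hit : ∀ (n : ℕ) (y : D), (⇑φ)^[n] y = (φ ^ n) y := by
    intro n
    induction n with
    | zero => intro y; simp
    | succ n ih => intro y; rw [Function.iterate_succ_apply, ih, pow_succ, RingAut.mul_apply]
  have hF : ∀ l : ℤ, ξ * (φ ^ (l * (a : ℤ))) x = (φ ^ ((l + 1) * (a : ℤ))) x * ξ := by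
    intro l
    have h := congrArg (φ ^ (l * (a : ℤ))) hcomm
    rw [map_mul, map_mul, hfixZ, hit, ← RingAut.mul_apply, ← zpow_natCast, ← zpow_add] at h
    rw [h, add_mul, one_mul]
  have hstep : ∀ l : ℤ, z (2 * (l + 1)) * ξ = ξ * z (2 * l) := by
    intro l
    rw [show 2 * (l + 1) = (2 * l + 1) + 1 by ring, hz, hz, mul_inv_rev, inv_inv]
    simp [mul_assoc, hξ]
  have heven : ∀ l : ℤ, z (2 * l) = (φ ^ (l * (a : ℤ))) x := by
    intro l
    induction l using Int.induction_on with
    | zero => simp [hz0]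
    | succ n ih =>
      apply mul_right_cancel₀ hξ
      rw [hstep, ih, hF]
    | pred n ih =>
      apply mul_left_cancel₀ hξ
      rw [← hstep, hF, sub_add_cancel, ih]
  have hodd : ∀ l : ℤ, z (2 * l + 1) = (φ ^ ((l + 1) * (a : ℤ))) x⁻¹ * ξ := by
    intro l
    have h0 : ∀ m : ℤ, (φ ^ m) x ≠ 0 := fun m => (map_ne_zero_iff _ (φ ^ m).injective).2 hx
    have h1 : (φ ^ ((l + 1) * (a : ℤ))) x⁻¹ = ((φ ^ ((l + 1) * (a : ℤ))) x)⁻¹ := map_inv₀ _ _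
    rw [hz, heven, h1, mul_inv_eq_iff_eq_mul₀ (h0 _), mul_assoc, hF, inv_mul_cancel_left₀ (h0 _)]
  refine ⟨fun l => ⟨heven l, hodd l⟩, ?_⟩
  ext y
  constructor
  · rintro ⟨k, rfl⟩
    obtain ⟨l, rfl | rfl⟩ := k.even_or_odd'
    · exact Or.inl ⟨l, heven l⟩
    · exact Or.inr ⟨l + 1, hodd l⟩
  · rintro (⟨l, rfl⟩ | ⟨l, rfl⟩)
    · exact ⟨2 * l, heven l⟩
    · exact ⟨2 * (l - 1) + 1, by rw [hodd, sub_add_cancel]⟩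
end

section
/- Let D be a division ring, φ a ring automorphism of D, x, ξ ∈ D with x ≠ 0, ξ ≠ 0, φ(ξ) = ξ, and ξ * x = φ^[a](x) * ξ for a natural number a. Let z : ℤ → D be the mutation sequence for (x, ξ). Then for all l, j ∈ ℤ one has φ^(l·a)(z j) = z (j + 2l), where φ^m for m ∈ ℤ denotes the m-th power of φ in the group of ring automorphisms of D. In particular, for every l ∈ ℤ the automorphism φ^(l·a) maps the cluster set {z k : k ∈ ℤ} bijectively onto itself, i.e. it is a cluster variable preserver. -/
/-- Theorem 3.17 in rank one: the automorphism `φ^(l·a)` acts on the mutation sequence as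
the shift by `2l`, hence maps the cluster set bijectively onto itself
(it is a cluster variable preserver). -/
theorem statement7 {D : Type*} [DivisionRing D] (φ : RingAut D) (x ξ : D)
    (hx : x ≠ 0) (hξ : ξ ≠ 0) (a : ℕ)
    (hfix : φ ξ = ξ) (hcomm : ξ * x = (⇑φ)^[a] x * ξ)
    (z : ℤ → D) (hz0 : z 0 = x) (hz : ∀ k : ℤ, z (k + 1) = ξ * (z k)⁻¹) :
    (∀ l j : ℤ, (φ ^ (l * (a : ℤ))) (z j) = z (j + 2 * l)) ∧
    ∀ l : ℤ, Set.BijOn (⇑(φ ^ (l * (a : ℤ)))) (Set.range z) (Set.range z) := by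
  have hback : ∀ k : ℤ, z k = (ξ⁻¹ * z (k + 1))⁻¹ := by
    intro k
    rw [hz k, inv_mul_cancel_left₀ hξ, inv_inv]
  obtain ⟨ψ, hψ⟩ : ∃ ψ : RingAut D, ψ = φ ^ a := ⟨_, rfl⟩
  have hpow : ∀ (n : ℕ) (y : D), (φ ^ n) y = (⇑φ)^[n] y := by
    intro n
    induction n with
    | zero => intro y; simp
    | succ n ih =>
      intro y
      rw [pow_succ, RingAut.mul_apply, ih, Function.iterate_succ_apply]
  have hψξ : ψ ξ = ξ := by
    rw [hψ, hpow]
    exact Function.iterate_fixed hfix a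
  have hψ0 : ψ (z 0) = z (0 + 2) := by
    have h2 : z (0 + 2) = ξ * (z (0 + 1))⁻¹ := by rw [← hz]; norm_num
    rw [h2, hz 0, hz0, mul_inv_rev, inv_inv, ← mul_assoc, hcomm, hψ, hpow,
      mul_inv_cancel_right₀ hξ]
  have hshift : ∀ j : ℤ, ψ (z j) = z (j + 2) := by
    intro j
    induction j using Int.induction_on with
    | zero => exact hψ0
    | succ i ih =>
      rw [hz, map_mul, map_inv₀, hψξ, ih, ← hz]
      congr 1 <;> ring
    | pred i ih =>
      rw [hback (-(i : ℤ) - 1), hback (-(i : ℤ) - 1 + 2), map_inv₀, map_mul, map_inv₀, hψξ,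
        sub_add_cancel, ih]
      congr 3 <;> ring
  have hinv : ∀ j : ℤ, ψ⁻¹ (z j) = z (j - 2) := by
    intro j
    have h := hshift (j - 2)
    rw [sub_add_cancel] at h
    rw [← h, ← RingAut.mul_apply, inv_mul_cancel, RingAut.one_apply]
  have main : ∀ l j : ℤ, (φ ^ (l * (a : ℤ))) (z j) = z (j + 2 * l) := by
    intro l
    rw [mul_comm, zpow_mul, zpow_natCast, ← hψ]
    induction l using Int.induction_on with
    | zero => intro j; simp
    | succ i ih =>
      intro j
      rw [zpow_add_one, RingAut.mul_apply, hshift, ih]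
      congr 1 <;> ring
    | pred i ih =>
      intro j
      rw [zpow_sub_one, RingAut.mul_apply, hinv, ih]
      congr 1 <;> ring
  refine ⟨main, fun l => ⟨?_, (RingEquiv.injective _).injOn, ?_⟩⟩
  · rintro _ ⟨j, rfl⟩
    exact ⟨_, (main l j).symm⟩
  · rintro _ ⟨j, rfl⟩
    refine ⟨z (j - 2 * l), ⟨_, rfl⟩, ?_⟩
    rw [main, sub_add_cancel]
end

section
/- Let D be a division ring and φ a ring automorphism of D. Let n ≥ 1 and for each k ∈ {1,…,n} let x_k, ξ_k ∈ D be nonzero elements with φ(ξ_k) = ξ_k, and let a_k ≥ 1 be an integer such that ξ_k * x_k = φ^[a_k](x_k) * ξ_k. For each k let z^(k) : ℤ → D be the mutation sequence for (x_k, ξ_k). Assume that the smallest sub-division-ring of D containing the fixed-point set {d ∈ D : φ(d) = d} together with x_1, …, x_n is D itself. Then the cluster set X := ⋃_{k=1}^n {z^(k) j : j ∈ ℤ} is finite if and only if φ has finite order, i.e. there exists an integer r ≥ 1 with φ^[r] = id_D. -/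
theorem mut_step {D : Type*} [DivisionRing D] (ψ : D →+* D) (x ξ : D) (hξ : ξ ≠ 0)
    (hfix : ψ ξ = ξ) (hcomm : ξ * x = ψ x * ξ) (z : ℤ → D) (hz0 : z 0 = x)
    (hz : ∀ j : ℤ, z (j + 1) = ξ * (z j)⁻¹) (j : ℤ) : z (j + 2) = ψ (z j) := by
  have key : ∀ j : ℤ, z (j + 2) = ψ (z j) ↔ z (j + 1 + 2) = ψ (z (j + 1)) := by
    intro j
    have e : j + 1 + 2 = (j + 2) + 1 := by ring
    rw [e, hz (j + 2), hz j, map_mul, hfix, map_inv₀]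
    constructor
    · intro h
      rw [h]
    · intro h
      exact inv_injective (mul_left_cancel₀ hξ h)
  induction j using Int.induction_on with
  | zero =>
    have e : (0 : ℤ) + 2 = (0 + 1) + 1 := by norm_num
    rw [e, hz, hz, hz0, mul_inv_rev, inv_inv, ← mul_assoc, hcomm, mul_assoc,
      mul_inv_cancel₀ hξ, mul_one]
  | succ i ih => exact (key _).1 ih
  | pred i ih =>
    refine (key _).2 ?_
    rw [sub_add_cancel]
    exact ih

theorem mut_iter {D : Type*} [DivisionRing D] (ψ : D →+* D) (z : ℤ → D)
    (h : ∀ j, z (j + 2) = ψ (z j)) (m : ℕ) (j : ℤ) : z (j + 2 * m) = ψ^[m] (z j) := by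
  induction m with
  | zero => simp
  | succ m ih =>
    rw [Function.iterate_succ_apply', ← ih, ← h]
    congr 1
    push_cast
    ring

/-- Theorem 3.15 (Theorem 1.1): for a balanced φ-commutative preseed of rank `n` whose
ambient division ring is generated (as a division ring) by the fixed points of `φ`
together with the initial cluster variables, the set of all cluster variables is finite
if and only if `φ` is of finite order. -/
theorem statement8 {D : Type*} [DivisionRing D] (φ : D ≃+* D) (n : ℕ) (hn : 1 ≤ n)
    (x ξ : Fin n → D) (a : Fin n → ℕ)
    (hx : ∀ k, x k ≠ 0) (hξ : ∀ k, ξ k ≠ 0) (ha : ∀ k, 1 ≤ a k)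
    (hfix : ∀ k, φ (ξ k) = ξ k)
    (hcomm : ∀ k, ξ k * x k = (⇑φ)^[a k] (x k) * ξ k)
    (z : Fin n → ℤ → D) (hz0 : ∀ k, z k 0 = x k)
    (hz : ∀ k, ∀ j : ℤ, z k (j + 1) = ξ k * (z k j)⁻¹)
    (hgen : Subfield.closure ({d : D | φ d = d} ∪ Set.range x) = ⊤) :
    (⋃ k, Set.range (z k)).Finite ↔ ∃ r : ℕ, 1 ≤ r ∧ (⇑φ)^[r] = id := by
  have hstep : ∀ k j, z k (j + 2) = ((φ : D →+* D) ^ a k) (z k j) := by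
    intro k
    refine mut_step _ (x k) (ξ k) (hξ k) ?_ ?_ (z k) (hz0 k) (hz k)
    · rw [RingHom.coe_pow]
      exact Function.iterate_fixed (hfix k) _
    · rw [RingHom.coe_pow]
      exact hcomm k
  have hiter : ∀ k (m : ℕ) j, z k (j + 2 * m) = (⇑φ)^[a k * m] (z k j) := by
    intro k m j
    rw [mut_iter _ (z k) (hstep k), RingHom.coe_pow, Function.iterate_mul]
    rfl
  constructor
  · intro hfin
    have hex : ∀ k, ∃ r : ℕ, 1 ≤ r ∧ (⇑φ)^[r] (x k) = x k := by
      intro k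
      have hf : (Set.range (z k)).Finite := hfin.subset (Set.subset_iUnion (fun k => Set.range (z k)) k)
      obtain ⟨m, -, m', -, hlt, he⟩ := Set.infinite_univ.exists_lt_map_eq_of_mapsTo
        (f := fun m : ℕ => z k (0 + 2 * m)) (t := Set.range (z k))
        (fun m _ => ⟨_, rfl⟩) hf
      simp only [hiter, hz0] at he
      obtain ⟨d, rfl⟩ := Nat.exists_eq_add_of_lt hlt
      refine ⟨a k * (d + 1), Nat.mul_pos (ha k) (Nat.succ_pos d), ?_⟩
      rw [add_assoc, mul_add, Function.iterate_add_apply] at he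
      exact (φ.injective.iterate _ he).symm
    choose r hr1 hr using hex
    refine ⟨∏ k, r k, Nat.succ_le_of_lt (Finset.prod_pos fun k _ => hr1 k), ?_⟩
    have hall : ∀ d ∈ Subfield.closure ({d : D | φ d = d} ∪ Set.range x),
        ((φ : D →+* D) ^ (∏ k, r k)) d = d := by
      intro d hd
      have hle : Subfield.closure ({d : D | φ d = d} ∪ Set.range x) ≤
          RingHom.eqLocusField ((φ : D →+* D) ^ (∏ k, r k)) (RingHom.id D) := by
        rw [Subfield.closure_le]
        rintro y (hy | ⟨k, rfl⟩)
        · change ((φ : D →+* D) ^ (∏ k, r k)) y = y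
          rw [RingHom.coe_pow]
          exact Function.iterate_fixed hy _
        · change ((φ : D →+* D) ^ (∏ k, r k)) (x k) = x k
          rw [RingHom.coe_pow]
          obtain ⟨c, hc⟩ := Finset.dvd_prod_of_mem r (Finset.mem_univ k)
          rw [hc, Function.iterate_mul]
          exact Function.iterate_fixed (hr k) _
      exact hle hd
    funext d
    have := hall d (by rw [hgen]; trivial)
    rw [RingHom.coe_pow] at this
    exact this
  · rintro ⟨r, hr1, hr⟩
    refine Set.finite_iUnion fun k => ?_
    have hp : Function.Periodic (z k) (2 * r : ℤ) := by
      intro j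
      rw [hiter, mul_comm, Function.iterate_mul, hr]
      simp
    rw [← hp.image_Ioc (by omega) 0]
    exact (Set.finite_Ioc _ _).image _
end

section
/- Let D be a division ring and x, ξ ∈ D with x ≠ 0 and ξ ≠ 0. Assume that x * ξ * x⁻¹ commutes with ξ and that x⁻¹ * ξ * x commutes with ξ. Let z : ℤ → D be the mutation sequence for (x, ξ). Then: (i) z (k+1) * z k = ξ for every k ∈ ℤ; (ii) z (2l) * z (2l+1) = x * ξ * x⁻¹ for every l ∈ ℤ; and (iii) z (2l+1) * z (2l+2) = x⁻¹ * ξ * x for every l ∈ ℤ. Thus every adjacent pair of cluster variables in the exchange graph satisfies the same pair of relations (product in one order equal to ξ, in the other order equal to a fixed conjugate of ξ), i.e. each vertex of the exchange graph gives rise to a copy of the defining relations of a rank-one generalized Weyl algebra. -/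
/-- Remark 4.11 / Theorem 4.12(1) in rank one: along the mutation sequence for `(x, ξ)`,
every adjacent pair of cluster variables satisfies `z (k+1) * z k = ξ` together with
`z (2l) * z (2l+1) = x * ξ * x⁻¹` and `z (2l+1) * z (2l+2) = x⁻¹ * ξ * x`, i.e. each
vertex of the exchange graph carries the defining relations of a rank-one generalized
Weyl algebra (with `x ξ x⁻¹` and `x⁻¹ ξ x` playing the roles of `θ ξ` and `θ⁻¹ ξ`). -/
theorem statement11 {D : Type*} [DivisionRing D] (x ξ : D) (hx : x ≠ 0) (hξ : ξ ≠ 0)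
    (h1 : Commute (x * ξ * x⁻¹) ξ) (h2 : Commute (x⁻¹ * ξ * x) ξ)
    (z : ℤ → D) (hz0 : z 0 = x) (hz : ∀ k : ℤ, z (k + 1) = ξ * (z k)⁻¹) :
    (∀ k : ℤ, z (k + 1) * z k = ξ) ∧
    (∀ l : ℤ, z (2 * l) * z (2 * l + 1) = x * ξ * x⁻¹) ∧
    (∀ l : ℤ, z (2 * l + 1) * z (2 * l + 2) = x⁻¹ * ξ * x) := by
  have hne : ∀ k : ℤ, z k ≠ 0 := by
    intro k
    induction k using Int.induction_on with
    | zero => rw [hz0]; exact hx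
    | succ i ih => rw [hz]; exact mul_ne_zero hξ (inv_ne_zero ih)
    | pred i ih =>
      intro h
      apply ih
      have := hz (-(i : ℤ) - 1)
      rw [h, sub_add_cancel] at this
      simpa using this
  have hstep : ∀ l : ℤ, z (2 * (l + 1)) = ξ * z (2 * l) * ξ⁻¹ := by
    intro l
    have e : 2 * (l + 1) = (2 * l + 1) + 1 := by ring
    rw [e, hz, hz, mul_inv_rev, inv_inv, mul_assoc]
  have key : ∀ l : ℤ, SemiconjBy (z (2 * l)) ξ (x * ξ * x⁻¹) ∧
      SemiconjBy (z (2 * l)) (x⁻¹ * ξ * x) ξ := by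
    have a1 : SemiconjBy ξ (x * ξ * x⁻¹) (x * ξ * x⁻¹) := h1.symm
    have a2 : SemiconjBy ξ⁻¹ (x * ξ * x⁻¹) (x * ξ * x⁻¹) := Commute.inv_left₀ h1.symm
    have b1 : SemiconjBy ξ (x⁻¹ * ξ * x) (x⁻¹ * ξ * x) := h2.symm
    have b2 : SemiconjBy ξ⁻¹ (x⁻¹ * ξ * x) (x⁻¹ * ξ * x) := Commute.inv_left₀ h2.symm
    have c1 : SemiconjBy ξ ξ ξ := Commute.refl ξ
    have c2 : SemiconjBy ξ⁻¹ ξ ξ := Commute.inv_left₀ (Commute.refl ξ)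
    intro l
    induction l using Int.induction_on with
    | zero =>
      rw [mul_zero, hz0]
      constructor
      · simp [SemiconjBy, mul_assoc, hx]
      · simp [SemiconjBy, ← mul_assoc, hx]
    | succ i ih =>
      rw [hstep]
      exact ⟨(a1.mul_left ih.1).mul_left c2, (c1.mul_left ih.2).mul_left b2⟩
    | pred i ih =>
      have h := hstep (-(i : ℤ) - 1)
      rw [sub_add_cancel] at h
      have e : z (2 * (-(i : ℤ) - 1)) = ξ⁻¹ * z (2 * -(i : ℤ)) * ξ := by
        rw [h]; simp [mul_assoc, hξ]
      rw [e]
      exact ⟨(a2.mul_left ih.1).mul_left c1, (c2.mul_left ih.2).mul_left b1⟩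
  refine ⟨fun k => ?_, fun l => ?_, fun l => ?_⟩
  · rw [hz, mul_assoc, inv_mul_cancel₀ (hne k), mul_one]
  · rw [hz, ← mul_assoc, (key l).1.eq, mul_assoc, mul_inv_cancel₀ (hne _), mul_one]
  · have e : 2 * l + 2 = 2 * (l + 1) := by ring
    have h := (key l).2.eq
    rw [e, hstep, hz]
    calc ξ * (z (2 * l))⁻¹ * (ξ * z (2 * l) * ξ⁻¹)
        = ξ * (z (2 * l))⁻¹ * (z (2 * l) * (x⁻¹ * ξ * x) * ξ⁻¹) := by rw [h]
      _ = ξ * (x⁻¹ * ξ * x) * ξ⁻¹ := by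
        rw [mul_assoc (z (2 * l)), mul_assoc ξ, inv_mul_cancel_left₀ (hne _), mul_assoc ξ]
      _ = x⁻¹ * ξ * x := by
        rw [h2.symm.eq, mul_assoc, mul_inv_cancel₀ hξ, mul_one]
end

section
/- Let D be a division ring and x, y ∈ D with x * y − y * x = 1 (so automatically x ≠ 0 and y ≠ 0). Set ξ := x * y and let z : ℤ → D be the mutation sequence for (y, ξ), i.e. z 0 = y and z (k+1) = ξ * (z k)⁻¹ for every k ∈ ℤ. Then: (i) z 1 = x; (ii) z (2k) = ξ^k * y * ξ^(−k) and z (2k+1) = ξ^k * x * ξ^(−k) for every k ∈ ℤ; and (iii) for every k ∈ ℤ, z (2k+1) * z (2k) − z (2k) * z (2k+1) = 1 and z (2k−1) * z (2k) − z (2k) * z (2k−1) = 1, so every adjacent pair of cluster variables in the exchange graph satisfies the defining relation of the first Weyl algebra. -/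
/-- Example 4.14 (equations (4.16)–(4.17)): for `x * y - y * x = 1` and `ξ = x * y`, the
mutation sequence for `(y, ξ)` is the ℤ-indexed chain with `z 1 = x`,
`z (2k) = ξ^k y ξ^(-k)`, `z (2k+1) = ξ^k x ξ^(-k)`, and every adjacent pair of cluster
variables satisfies the defining relation of the first Weyl algebra. -/
theorem statement12 {D : Type*} [DivisionRing D] (x y : D) (h : x * y - y * x = 1)
    (ξ : D) (hξdef : ξ = x * y)
    (z : ℤ → D) (hz0 : z 0 = y) (hz : ∀ k : ℤ, z (k + 1) = ξ * (z k)⁻¹) :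
    z 1 = x ∧
    (∀ k : ℤ, z (2 * k) = ξ ^ k * y * ξ ^ (-k) ∧ z (2 * k + 1) = ξ ^ k * x * ξ ^ (-k)) ∧
    (∀ k : ℤ, z (2 * k + 1) * z (2 * k) - z (2 * k) * z (2 * k + 1) = 1 ∧
      z (2 * k - 1) * z (2 * k) - z (2 * k) * z (2 * k - 1) = 1) := by
  have hx : x ≠ 0 := by
    rintro rfl
    simp at h
  have hy : y ≠ 0 := by
    rintro rfl
    simp at h
  have hξ : ξ ≠ 0 := by
    rw [hξdef]
    exact mul_ne_zero hx hy
  have hξy : ξ * y⁻¹ = x := by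
    rw [hξdef, mul_assoc, mul_inv_cancel₀ hy, mul_one]
  have h2 : ∀ k, z (k + 2) = ξ * z k * ξ⁻¹ := by
    intro k
    have e : k + 2 = k + 1 + 1 := by ring
    rw [e, hz, hz, mul_inv_rev, inv_inv, mul_assoc]
  have heven : ∀ k : ℤ, z (2 * k) = ξ ^ k * y * (ξ ^ k)⁻¹ := by
    intro k
    induction k using Int.induction_on with
    | zero => simp [hz0]
    | succ n ih =>
      have e : (2 : ℤ) * (n + 1) = 2 * n + 2 := by ring
      have e' : ξ ^ ((n : ℤ) + 1) = ξ * ξ ^ (n : ℤ) := by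
        rw [add_comm, zpow_add₀ hξ, zpow_one]
      rw [e, h2, ih, e', mul_inv_rev]
      simp only [mul_assoc]
    | pred n ih =>
      have e : (2 : ℤ) * (-n) = 2 * (-n - 1) + 2 := by ring
      have e' : ξ ^ (-(n : ℤ) - 1) = ξ⁻¹ * ξ ^ (-(n : ℤ)) := by
        rw [sub_eq_neg_add, zpow_add₀ hξ, zpow_neg_one]
      rw [e, h2] at ih
      have : z (2 * (-n - 1)) = ξ⁻¹ * (ξ * z (2 * (-n - 1)) * ξ⁻¹) * ξ := by
        simp [mul_assoc, hξ]
      rw [this, ih, e', mul_inv_rev, inv_inv]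
      simp only [mul_assoc]
  have hodd : ∀ k : ℤ, z (2 * k + 1) = ξ ^ k * x * (ξ ^ k)⁻¹ := by
    intro k
    have c : ξ * ξ ^ k = ξ ^ k * ξ := ((Commute.refl ξ).zpow_right₀ k).eq
    rw [hz, heven, mul_inv_rev, mul_inv_rev, inv_inv, ← mul_assoc, ← hξy, ← mul_assoc,
      ← mul_assoc, ← c, mul_assoc ξ]
  have hconj : ∀ a u v : D, a ≠ 0 → u * v - v * u = 1 →
      (a * u * a⁻¹) * (a * v * a⁻¹) - (a * v * a⁻¹) * (a * u * a⁻¹) = 1 := by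
    intro a u v ha huv
    have : (a * u * a⁻¹) * (a * v * a⁻¹) - (a * v * a⁻¹) * (a * u * a⁻¹)
        = a * (u * v - v * u) * a⁻¹ := by
      simp [mul_assoc, ha, mul_sub, sub_mul]
    rw [this, huv, mul_one, mul_inv_cancel₀ ha]
  refine ⟨?_, ?_, ?_⟩
  · simpa using hodd 0
  · intro k
    rw [zpow_neg]
    exact ⟨heven k, hodd k⟩
  · intro k
    have hk : ξ ^ k ≠ 0 := zpow_ne_zero k hξ
    refine ⟨?_, ?_⟩
    · rw [heven, hodd]
      exact hconj _ _ _ hk h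
    · have e : 2 * k - 1 = 2 * (k - 1) + 1 := by ring
      have e' : ξ ^ (k - 1) = ξ ^ k * ξ⁻¹ := zpow_sub_one₀ hξ k
      have hm : z (2 * k - 1) = ξ ^ k * (y⁻¹ * x * y) * (ξ ^ k)⁻¹ := by
        rw [e, hodd, e', mul_inv_rev, inv_inv]
        have : ξ⁻¹ * x * ξ = y⁻¹ * x * y := by
          rw [hξdef, mul_inv_rev]
          simp [mul_assoc, hx]
        rw [← this]
        simp only [mul_assoc]
      rw [hm, heven]
      refine hconj _ _ _ hk ?_
      have hxy : x * y = y * x + 1 := by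
        rw [← h]
        abel
      have h3 : y⁻¹ * x * y = x + y⁻¹ := by
        rw [mul_assoc, hxy, mul_add, mul_one, inv_mul_cancel_left₀ hy]
      rw [h3, add_mul, mul_add, inv_mul_cancel₀ hy, mul_inv_cancel₀ hy, hxy]
      abel
end
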